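/- For all integers n ≥ 1 and 0 < k ≤ n, the following polynomial identity in ℤ[q] holds: Σ_{σ ∈ A(n,k)} q^{inv(σ)} = ([k+1]_q)^{n−k} · [k]_q!. -/

import Mathlib

attribute [local instance] Classical.propDecidable

/-- The maximum drop size of a permutation (0-indexed positions and values). -/
def maxdrop {n : ℕ} (π : Equiv.Perm (Fin n)) : ℕ :=
  Finset.univ.sup fun i : Fin n => (i : ℕ) - (π i : ℕ)

/-- `A(n,k)`: permutations of `[n]` with maximum drop size at most `k`. -/
def bddA (n k : ℕ) : Finset (Equiv.Perm (Fin n)) :=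
  Finset.univ.filter fun π => maxdrop π ≤ k

/-- `S(n,k)`: permutations of `[n]` with `σ i - i ≤ k` for all `i`. -/
def bddS (n k : ℕ) : Finset (Equiv.Perm (Fin n)) :=
  Finset.univ.filter fun π => ∀ i : Fin n, (π i : ℕ) ≤ (i : ℕ) + k

/-- The number of inversions of a permutation. -/
def invStat {n : ℕ} (π : Equiv.Perm (Fin n)) : ℕ :=
  (Finset.univ.filter fun p : Fin n × Fin n => p.1 < p.2 ∧ π p.2 < π p.1).card

/-- The number of left-to-right maxima of a permutation. -/
def lmaxStat {n : ℕ} (π : Equiv.Perm (Fin n)) : ℕ :=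
  (Finset.univ.filter fun i : Fin n => ∀ j, j < i → π j < π i).card

/-- The number of cycles of a permutation, fixed points included. -/
def cycStat {n : ℕ} (π : Equiv.Perm (Fin n)) : ℕ :=
  π.cycleType.card + (Finset.univ.filter fun i => π i = i).card

/-- The sorting index: `σ` has a unique factorization
`σ = (i₁,j₁)(i₂,j₂)⋯(iₘ,jₘ)` into transpositions with `j₁ < j₂ < ⋯ < jₘ` and
`iᵣ < jᵣ` for all `r`, and `sor σ = Σᵣ (jᵣ - iᵣ)`. -/
noncomputable def sorStat {n : ℕ} (σ : Equiv.Perm (Fin n)) : ℕ :=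
  if h : ∃ l : List (Fin n × Fin n),
      (∀ p ∈ l, p.1 < p.2) ∧ l.Chain' (fun p q => p.2 < q.2) ∧
      σ = (l.map fun p => Equiv.swap p.1 p.2).prod
  then (h.choose.map fun p => (p.2 : ℕ) - (p.1 : ℕ)).sum
  else 0

/-- `DIS σ = sor σ⁻¹`. -/
noncomputable def DIS {n : ℕ} (σ : Equiv.Perm (Fin n)) : ℕ := sorStat σ⁻¹

/-- 213-avoiding permutations: no `i < j < l` with `π j < π i < π l`. -/
def avoids213 {n : ℕ} (π : Equiv.Perm (Fin n)) : Prop :=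
  ¬ ∃ i j l : Fin n, i < j ∧ j < l ∧ π j < π i ∧ π i < π l

/-- 132-avoiding permutations: no `i < j < l` with `π i < π l < π j`. -/
def avoids132 {n : ℕ} (π : Equiv.Perm (Fin n)) : Prop :=
  ¬ ∃ i j l : Fin n, i < j ∧ j < l ∧ π i < π l ∧ π l < π j

/-- 321-avoiding permutations: no `i < j < l` with `π i > π j > π l`. -/
def avoids321 {n : ℕ} (π : Equiv.Perm (Fin n)) : Prop :=
  ¬ ∃ i j l : Fin n, i < j ∧ j < l ∧ π l < π j ∧ π j < π i

/-- The number of descents of a permutation. -/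
def desStat {n : ℕ} (π : Equiv.Perm (Fin n)) : ℕ :=
  (Finset.univ.filter fun i : Fin n =>
    ∃ j : Fin n, (j : ℕ) = (i : ℕ) + 1 ∧ π j < π i).card

/-- The number of right-to-left maxima of a permutation. -/
def rmaxStat {n : ℕ} (π : Equiv.Perm (Fin n)) : ℕ :=
  (Finset.univ.filter fun i : Fin n => ∀ j, i < j → π j < π i).card

/-- The number of non-weak excedances before the last position. -/
def vnwStat {N : ℕ} (π : Equiv.Perm (Fin N)) : ℕ :=
  (Finset.univ.filter fun i : Fin N => (i : ℕ) + 1 < N ∧ (π i : ℕ) < (i : ℕ)).card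

/-- `Γ_{n,k}`: sequences of `n` ones (`true`) and `k` negative ones (`false`)
with all partial sums nonnegative. -/
noncomputable def GammaBP (n k : ℕ) : Finset (Fin (n + k) → Bool) :=
  Finset.univ.filter fun a =>
    (Finset.univ.filter fun i => a i = true).card = n ∧
    ∀ m ∈ Finset.range (n + k + 1),
      (Finset.univ.filter fun i : Fin (n + k) => (i : ℕ) < m ∧ a i = false).card ≤
      (Finset.univ.filter fun i : Fin (n + k) => (i : ℕ) < m ∧ a i = true).card

/-- `vpk a`: the number of ones immediately followed by a `-1` that are not the
rightmost one. -/
def vpkStat {N : ℕ} (a : Fin N → Bool) : ℕ :=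
  (Finset.univ.filter fun i : Fin N =>
    a i = true ∧ (∃ j : Fin N, (j : ℕ) = (i : ℕ) + 1 ∧ a j = false) ∧
    ∃ j : Fin N, i < j ∧ a j = true).card

/-- `Γ^u_{n,k}`: elements of `Γ_{n,k}` ending with a one. -/
noncomputable def GammaBPU (n k : ℕ) : Finset (Fin (n + k) → Bool) :=
  (GammaBP n k).filter fun a => ∀ i : Fin (n + k), (i : ℕ) + 1 = n + k → a i = true

/-- `Γ^d_{n,k}`: elements of `Γ_{n,k}` ending with a negative one. -/
noncomputable def GammaBPD (n k : ℕ) : Finset (Fin (n + k) → Bool) :=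
  (GammaBP n k).filter fun a => ∀ i : Fin (n + k), (i : ℕ) + 1 = n + k → a i = false

/-- The transposition `t_{i,j}` of `1`-based positions `i` and `j`. -/
def transp (n i j : ℕ) : Equiv.Perm (Fin n) :=
  if h : i - 1 < n ∧ j - 1 < n then Equiv.swap ⟨i - 1, h.1⟩ ⟨j - 1, h.2⟩ else 1

/-- `Ψ_{i,k} = 1 + sᵢ + sᵢsᵢ₋₁ + ⋯` (with `min i k + 1` terms) in `ℤ[Sₙ]`,
where `sᵢ = (i, i+1)` (1-based). -/
noncomputable def PsiElt (n k i : ℕ) : MonoidAlgebra ℤ (Equiv.Perm (Fin n)) :=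
  ∑ m ∈ Finset.range (min i k + 1),
    MonoidAlgebra.of ℤ (Equiv.Perm (Fin n))
      (((List.range m).map fun r => transp n (i - r) (i - r + 1)).prod)

/-- `Φ_{i,k} = 1 + t_{i,i+1} + t_{i-1,i+1} + ⋯` (with `min i k + 1` terms)
in `ℤ[Sₙ]`. -/
noncomputable def PhiElt (n k i : ℕ) : MonoidAlgebra ℤ (Equiv.Perm (Fin n)) :=
  ∑ m ∈ Finset.range (min i k + 1),
    MonoidAlgebra.of ℤ (Equiv.Perm (Fin n)) (transp n (i + 1 - m) (i + 1))

/-- `[i]_q = 1 + q + ⋯ + q^{i-1}` as an element of `ℤ[q,t]`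
(with `q = X 0`, `t = X 1`). -/
noncomputable def qBracket (i : ℕ) : MvPolynomial (Fin 2) ℤ :=
  ∑ j ∈ Finset.range i, MvPolynomial.X 0 ^ j

/-- Insert the value `p.2` at the last position of `p.1`. -/
def insLast {n : ℕ} (p : Equiv.Perm (Fin n) × Fin (n + 1)) : Equiv.Perm (Fin (n + 1)) :=
  ((finSuccEquiv' (Fin.last n)).trans (Equiv.optionCongr p.1)).trans (finSuccEquiv' p.2).symm

theorem insLast_last {n : ℕ} (p : Equiv.Perm (Fin n) × Fin (n + 1)) :
    insLast p (Fin.last n) = p.2 := by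
  simp [insLast]

theorem insLast_castSucc {n : ℕ} (p : Equiv.Perm (Fin n) × Fin (n + 1)) (i : Fin n) :
    insLast p i.castSucc = p.2.succAbove (p.1 i) := by
  have h : finSuccEquiv' (Fin.last n) i.castSucc = some i := by
    have := finSuccEquiv'_succAbove (Fin.last n) i
    rwa [Fin.succAbove_last] at this
  simp [insLast, h]

theorem insLast_bij {n : ℕ} : Function.Bijective (@insLast n) := by
  rw [Fintype.bijective_iff_injective_and_card]
  constructor
  · intro p p' h
    have h2 : p.2 = p'.2 := by rw [← insLast_last p, h, insLast_last]
    refine Prod.ext (Equiv.ext fun i => ?_) h2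
    have := insLast_castSucc p i
    rw [h, insLast_castSucc, h2] at this
    exact (Fin.succAbove_right_injective this).symm
  · simp [Fintype.card_perm, Nat.factorial_succ, mul_comm]

theorem invStat_eq {n : ℕ} (π : Equiv.Perm (Fin n)) :
    invStat π = ∑ j, ∑ i, if i < j ∧ π j < π i then 1 else 0 := by
  rw [invStat, Finset.card_filter, Finset.sum_comm, ← Finset.univ_product_univ, Finset.sum_product]

theorem card_above {n : ℕ} (v : Fin (n + 1)) :
    (∑ j : Fin n, if v < v.succAbove j then 1 else 0) = n - (v : ℕ) := by
  simp only [Fin.lt_succAbove_iff_le_castSucc, Fin.le_def, Fin.val_castSucc]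
  rw [Fin.sum_univ_eq_sum_range (fun j => if (v : ℕ) ≤ j then 1 else 0) n, ← Finset.card_filter]
  have : Finset.filter (fun j => (v : ℕ) ≤ j) (Finset.range n) = Finset.Ico (v : ℕ) n := by
    ext j; simp; tauto
  rw [this, Nat.card_Ico]

theorem invStat_insLast {n : ℕ} (p : Equiv.Perm (Fin n) × Fin (n + 1)) :
    invStat (insLast p) = invStat p.1 + (n - (p.2 : ℕ)) := by
  rw [invStat_eq, invStat_eq, Fin.sum_univ_castSucc]
  congr 1
  · refine Finset.sum_congr rfl fun j _ => ?_
    rw [Fin.sum_univ_castSucc]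
    simp [insLast_castSucc, Fin.succAbove_lt_succAbove_iff, Fin.castSucc_lt_last, not_lt_of_gt]
  · rw [Fin.sum_univ_castSucc, ← card_above]
    simp only [insLast_castSucc, insLast_last, Fin.castSucc_lt_last, lt_self_iff_false, true_and,
      false_and, if_false, add_zero]
    exact Equiv.sum_comp p.1 (fun j => if p.2 < p.2.succAbove j then 1 else 0)

theorem mem_bddA {n k : ℕ} (π : Equiv.Perm (Fin n)) :
    π ∈ bddA n k ↔ ∀ i : Fin n, (i : ℕ) ≤ (π i : ℕ) + k := by
  simp [bddA, maxdrop, add_comm]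

theorem mem_insLast {n k : ℕ} (p : Equiv.Perm (Fin n) × Fin (n + 1)) :
    insLast p ∈ bddA (n + 1) k ↔ p.1 ∈ bddA n k ∧ n - (p.2 : ℕ) ≤ k := by
  rw [mem_bddA, mem_bddA, Fin.forall_fin_succ']
  simp only [insLast_castSucc, insLast_last, Fin.val_castSucc, Fin.val_last]
  have key : ∀ i : Fin n, ((p.2.succAbove (p.1 i) : Fin (n + 1)) : ℕ) =
      if (p.1 i : ℕ) < p.2 then (p.1 i : ℕ) else p.1 i + 1 := by
    intro i
    simp only [Fin.succAbove, Fin.lt_def, Fin.val_castSucc]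
    split_ifs <;> simp
  constructor
  · rintro ⟨h1, h2⟩
    refine ⟨fun i => ?_, by omega⟩
    have := h1 i
    rw [key] at this
    have := i.2
    split_ifs at * <;> omega
  · rintro ⟨h1, h2⟩
    refine ⟨fun i => ?_, by omega⟩
    have := h1 i
    rw [key]
    split_ifs <;> omega

theorem sum_last (n k : ℕ) :
    (∑ v : Fin (n + 1), if n - (v : ℕ) ≤ k then (Polynomial.X : Polynomial ℤ) ^ (n - (v : ℕ)) else 0)
      = ∑ j ∈ Finset.range (min n k + 1), (Polynomial.X : Polynomial ℤ) ^ j := by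
  rw [Fin.sum_univ_eq_sum_range
    (fun v => if n - v ≤ k then (Polynomial.X : Polynomial ℤ) ^ (n - v) else 0) (n + 1)]
  have := Finset.sum_range_reflect
    (fun v => if v ≤ k then (Polynomial.X : Polynomial ℤ) ^ v else 0) (n + 1)
  simp only [Nat.add_sub_cancel] at this
  rw [this, ← Finset.sum_filter]
  refine Finset.sum_congr ?_ fun _ _ => rfl
  ext j
  simp only [Finset.mem_filter, Finset.mem_range]
  omega

theorem gf_bddA (n k : ℕ) :
    ∑ σ ∈ bddA n k, (Polynomial.X : Polynomial ℤ) ^ invStat σ =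
      ∏ i ∈ Finset.range n, ∑ j ∈ Finset.range (min i k + 1), (Polynomial.X : Polynomial ℤ) ^ j := by
  induction n with
  | zero =>
    have : bddA 0 k = Finset.univ := by
      ext π
      rw [mem_bddA]
      exact iff_of_true (fun i => i.elim0) (Finset.mem_univ _)
    rw [this]
    simp [invStat]
  | succ n ih =>
    rw [Finset.prod_range_succ, ← ih, ← sum_last, Finset.sum_mul_sum, ← Finset.sum_product']
    have h1 : ∑ σ ∈ bddA (n + 1) k, (Polynomial.X : Polynomial ℤ) ^ invStat σ =
        ∑ σ, if σ ∈ bddA (n + 1) k then (Polynomial.X : Polynomial ℤ) ^ invStat σ else 0 := by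
      simp
    rw [h1, ← Function.Bijective.sum_comp insLast_bij, Fintype.sum_prod_type, Finset.sum_product,
      ← Finset.sum_subset (Finset.subset_univ (bddA n k))]
    · refine Finset.sum_congr rfl fun τ hτ => Finset.sum_congr rfl fun v _ => ?_
      simp only [mem_insLast, invStat_insLast, hτ, true_and, pow_add]
      split_ifs <;> simp
    · intro τ _ hτ
      simp [mem_insLast, hτ]

/-- the generating function of `inv` over `A(n,k)` equals
`[k+1]_q^{n-k}·[k]_q!` in `ℤ[q]`. -/
theorem stmt4 (n k : ℕ) (hn : 1 ≤ n) (hk0 : 0 < k) (hk : k ≤ n) :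
    ∑ σ ∈ bddA n k, (Polynomial.X : Polynomial ℤ) ^ invStat σ =
      (∑ j ∈ Finset.range (k + 1), (Polynomial.X : Polynomial ℤ) ^ j) ^ (n - k) *
        ∏ i ∈ Finset.Icc 1 k, ∑ j ∈ Finset.range i, (Polynomial.X : Polynomial ℤ) ^ j := by
  obtain ⟨m, rfl⟩ := Nat.exists_eq_add_of_le hk
  rw [gf_bddA, Finset.prod_range_add, mul_comm, Nat.add_sub_cancel_left]
  congr 1
  · simp
  · rw [← Finset.Ico_succ_right_eq_Icc, Finset.prod_Ico_eq_prod_range]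
    refine Finset.prod_congr (by simp) fun i hi => ?_
    rw [Finset.mem_range, Nat.succ_eq_succ, Nat.succ_eq_add_one] at hi
    rw [min_eq_left (by omega), add_comm]
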